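/- Let n ≥ 1 and let F₁, …, Fₙ be finite partially ordered sets, each with a chosen minimal element xᵢ ∈ Fᵢ. Let P be the poset of n-tuples σ with σᵢ ∈ Option Fᵢ (where none is below every element of Fᵢ), ordered componentwise, with the all-none tuple removed, and let g : P → {false < true}ⁿ be given by g(σ)ᵢ = true iff σᵢ ∉ {none, some xᵢ}. Let M be the set of all covering pairs of P obtained as follows: for each σ ∈ P with g(σ) ≠ (true,…,true), let l be the smallest index with g(σ)_l = false, and pair σ with the tuple obtained from σ by toggling coordinate l between none and some x_l; the pair (b, ·) involving only b = (some x₁, none, …, none) is omitted. Then M is an acyclic matching on P (every element occurs in at most one pair, each pair is a covering pair, and the modified Hasse relation of M has no directed cycle), the unmatched elements of P are exactly b together with the elements σ with g(σ) = (true,…,true), and the set Z of elements matched by M together with b is a lower set of P which contains every tuple σ having at least one coordinate equal to none. -/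

import Mathlib

section JoinCollapse

variable {n : ℕ} {F : Fin n → Type*} [∀ i, PartialOrder (F i)] [∀ i, DecidableEq (F i)]

/-- Toggling coordinate `l` of a tuple `σ` between `none` (= `⊥`) and `some (x l)`. -/
def toggle (x : ∀ i, F i) (l : Fin n) (σ : ∀ i, WithBot (F i)) : ∀ i, WithBot (F i) :=
  Function.update σ l (if σ l = ⊥ then (x l : WithBot (F l)) else ⊥)

/-- The map `g` to the Boolean lattice: `g σ i = true` iff `σ i ∉ {none, some (x i)}`. -/
noncomputable def gmap (x : ∀ i, F i) (σ : ∀ i, WithBot (F i)) : Fin n → Bool :=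
  fun i => decide (σ i ≠ ⊥ ∧ σ i ≠ (x i : WithBot (F i)))

/-- The special element `b = (some x₁, none, …, none)`. -/
def bElt (hn : 0 < n) (x : ∀ i, F i) : ∀ i, WithBot (F i) :=
  fun i => if i = (⟨0, hn⟩ : Fin n) then (x i : WithBot (F i)) else ⊥

end JoinCollapse

section JoinHelpers

variable {n : ℕ} {F : Fin n → Type*} [∀ i, PartialOrder (F i)] [∀ i, DecidableEq (F i)]

/-- `l` is the least index at which `gmap x σ` is `false`. -/
def LeastF (x : ∀ i, F i) (σ : ∀ i, WithBot (F i)) (l : Fin n) : Prop :=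
  gmap x σ l = false ∧ ∀ j : Fin n, j < l → gmap x σ j = true

lemma gmap_false (x : ∀ i, F i) (σ : ∀ i, WithBot (F i)) (i : Fin n) :
    gmap x σ i = false ↔ σ i = ⊥ ∨ σ i = (x i : WithBot (F i)) := by
  simp only [gmap, decide_eq_false_iff_not]
  tauto

lemma LeastF.unique {x : ∀ i, F i} {σ τ : ∀ i, WithBot (F i)} {l m : Fin n}
    (h : LeastF x σ l) (h' : LeastF x τ m) (e : gmap x σ = gmap x τ) : l = m := by
  obtain ⟨h1, h2⟩ := h
  obtain ⟨h3, h4⟩ := h'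
  rw [e] at h1 h2
  rcases lt_trichotomy l m with h | h | h
  · have := h4 _ h
    simp_all
  · exact h
  · have := h2 _ h
    simp_all

lemma exists_leastF (x : ∀ i, F i) (σ : ∀ i, WithBot (F i))
    (h : gmap x σ ≠ fun _ => true) : ∃ l, LeastF x σ l := by
  have h' : ∃ k, gmap x σ k = false := by
    by_contra hc
    push Not at hc
    exact h (funext fun i => by simpa using hc i)
  obtain ⟨k, hk, hm⟩ := WellFounded.has_min (wellFounded_lt (α := Fin n))
    {k | gmap x σ k = false} h'
  exact ⟨k, hk, fun j hj => by
    by_contra hc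
    exact hm j (by simpa using hc) hj⟩

lemma gmap_mono (x : ∀ i, F i) (hx : ∀ i, IsMin (x i)) {σ τ : ∀ i, WithBot (F i)}
    (h : τ ≤ σ) : gmap x τ ≤ gmap x σ := by
  intro i
  rcases hs : gmap x σ i with _ | _
  · rw [gmap_false] at hs
    have hi := h i
    have : gmap x τ i = false := by
      rw [gmap_false]
      rcases hs with hs | hs
      · left
        rw [hs] at hi
        exact le_bot_iff.1 hi
      · rw [hs] at hi
        rcases ht : τ i with _ | t
        · exact Or.inl rfl
        · right
          rw [ht] at hi
          have hi' : t ≤ x i := WithBot.coe_le_coe.1 hi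
          exact congrArg _ ((hx i).eq_of_le hi')
    rw [this]
  · exact Bool.le_true _

/-- The tuple with the coordinate at the least `false` index replaced by `⊥`. -/
noncomputable def dmap (x : ∀ i, F i) (σ : ∀ i, WithBot (F i)) : ∀ i, WithBot (F i) :=
  open Classical in fun i => if LeastF x σ i then ⊥ else σ i

/-- Structure of an upward pair. -/
def UpPair (x : ∀ i, F i) (l : Fin n) (a b : ∀ i, WithBot (F i)) : Prop :=
  LeastF x a l ∧ a l = ⊥ ∧ b l = (x l : WithBot (F l)) ∧ ∀ i, i ≠ l → b i = a i

lemma UpPair.gmap_eq {x : ∀ i, F i} {l : Fin n} {a b : ∀ i, WithBot (F i)}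
    (h : UpPair x l a b) : gmap x a = gmap x b := by
  obtain ⟨_, h1, h2, h3⟩ := h
  funext i
  by_cases hi : i = l
  · subst hi
    simp [gmap, h1, h2]
  · simp [gmap, h3 i hi]

lemma UpPair.lt {x : ∀ i, F i} {l : Fin n} {a b : ∀ i, WithBot (F i)}
    (h : UpPair x l a b) : a < b := by
  obtain ⟨_, h1, h2, h3⟩ := h
  refine lt_of_le_of_ne (fun i => ?_) (fun e => ?_)
  · by_cases hi : i = l
    · subst hi
      simp [h1]
    · rw [h3 i hi]
  · rw [e, h2] at h1
    exact WithBot.coe_ne_bot h1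

lemma UpPair.toggle_eq {x : ∀ i, F i} {l : Fin n} {a b : ∀ i, WithBot (F i)}
    (h : UpPair x l a b) : b = toggle x l a := by
  obtain ⟨_, h1, h2, h3⟩ := h
  funext i
  by_cases hi : i = l
  · subst hi
    simp [toggle, h1, h2]
  · simp [toggle, h3 i hi, hi]

lemma upPair_of_toggle {x : ∀ i, F i} {l : Fin n} {a b : ∀ i, WithBot (F i)}
    (hl : LeastF x a l) (hab : a < b) (hb : b = toggle x l a) : UpPair x l a b := by
  have h1 : a l = ⊥ := by
    by_contra hc
    have := hab.le l
    rw [hb] at this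
    simp [toggle, hc] at this
  refine ⟨hl, h1, ?_, fun i hi => ?_⟩
  · simp [hb, toggle, h1]
  · simp [hb, toggle, hi]

lemma UpPair.eq_or {x : ∀ i, F i} (hx : ∀ i, IsMin (x i)) {l : Fin n}
    {a b c : ∀ i, WithBot (F i)}
    (h : UpPair x l a b) (hac : a ≤ c) (hcb : c ≤ b) : c = a ∨ c = b := by
  obtain ⟨_, h1, h2, h3⟩ := h
  have hoff : ∀ i, i ≠ l → c i = a i := fun i hi =>
    le_antisymm ((hcb i).trans (h3 i hi).le) (hac i)
  have hl : c l = ⊥ ∨ c l = (x l : WithBot (F l)) := by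
    have hi := hcb l
    rw [h2] at hi
    rcases ht : c l with _ | t
    · exact Or.inl rfl
    · right
      rw [ht] at hi
      have hi' : t ≤ x l := WithBot.coe_le_coe.1 hi
      exact congrArg _ ((hx l).eq_of_le hi')
  rcases hl with hl | hl
  · left
    funext i
    by_cases hi : i = l
    · subst hi
      rw [hl, h1]
    · exact hoff i hi
  · right
    funext i
    by_cases hi : i = l
    · subst hi
      rw [hl, h2]
    · rw [hoff i hi, h3 i hi]

lemma leastF_congr {x : ∀ i, F i} {a b : ∀ i, WithBot (F i)}
    (e : gmap x a = gmap x b) (l : Fin n) : LeastF x a l ↔ LeastF x b l := by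
  simp only [LeastF, e]

lemma UpPair.dmap_eq {x : ∀ i, F i} {l : Fin n} {a b : ∀ i, WithBot (F i)}
    (h : UpPair x l a b) : dmap x a = dmap x b := by
  have e := h.gmap_eq
  obtain ⟨h0, h1, h2, h3⟩ := h
  funext i
  by_cases hi : i = l
  · subst hi
    simp [dmap, h0, (leastF_congr e _).1 h0]
  · by_cases hL : LeastF x a i
    · simp [dmap, hL, (leastF_congr e _).1 hL]
    · simp [dmap, hL, mt (leastF_congr e _).2 hL, h3 i hi]

/-- The strict order along which the modified Hasse relation moves. -/
def Desc (x : ∀ i, F i) (a b : ∀ i, WithBot (F i)) : Prop :=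
  gmap x b < gmap x a ∨ (gmap x b = gmap x a ∧
    (dmap x b < dmap x a ∨ (dmap x b = dmap x a ∧ a < b)))

lemma Desc.irrefl (x : ∀ i, F i) (a : ∀ i, WithBot (F i)) : ¬ Desc x a a := by
  simp [Desc]

lemma Desc.trans {x : ∀ i, F i} {a b c : ∀ i, WithBot (F i)} (h : Desc x a b)
    (h' : Desc x b c) : Desc x a c := by
  rcases h with h | ⟨h, h1⟩
  · rcases h' with h' | ⟨h', _⟩
    · exact Or.inl (h'.trans h)
    · exact Or.inl (h' ▸ h)
  · rcases h' with h' | ⟨h', h1'⟩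
    · exact Or.inl (h ▸ h')
    · refine Or.inr ⟨h'.trans h, ?_⟩
      rcases h1 with h1 | ⟨h1, h2⟩
      · rcases h1' with h1' | ⟨h1', _⟩
        · exact Or.inl (h1'.trans h1)
        · exact Or.inl (h1' ▸ h1)
      · rcases h1' with h1' | ⟨h1', h2'⟩
        · exact Or.inl (h1 ▸ h1')
        · exact Or.inr ⟨h1'.trans h1, h2.trans h2'⟩

lemma UpPair.desc {x : ∀ i, F i} {l : Fin n} {a b : ∀ i, WithBot (F i)}
    (h : UpPair x l a b) : Desc x a b :=
  Or.inr ⟨h.gmap_eq.symm, Or.inr ⟨h.dmap_eq.symm, h.lt⟩⟩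

lemma desc_of_lt {x : ∀ i, F i} (hx : ∀ i, IsMin (x i)) {a b : ∀ i, WithBot (F i)}
    (hba : b < a) (h : ∀ l, ¬ UpPair x l b a) : Desc x a b := by
  rcases (gmap_mono x hx hba.le).lt_or_eq with hg | hg
  · exact Or.inl hg
  refine Or.inr ⟨hg, Or.inl ?_⟩
  refine lt_of_le_of_ne (fun i => ?_) (fun e => ?_)
  · by_cases hL : LeastF x b i
    · simp [dmap, hL]
    · simpa [dmap, hL, mt (leastF_congr hg _).2 hL] using hba.le i
  · have hoff : ∀ i, ¬ LeastF x b i → a i = b i := fun i hi => by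
      have := congrFun e i
      simp only [dmap, if_neg (mt (leastF_congr hg _).2 hi), if_neg hi] at this
      exact this.symm
    by_cases hall : ∃ l, LeastF x b l
    · obtain ⟨l, hl⟩ := hall
      have hoff' : ∀ i, i ≠ l → a i = b i := fun i hi =>
        hoff i (fun hi' => hi (hi'.unique hl rfl))
      have hne : b l ≠ a l := fun hc => hba.ne (funext fun i => by
        by_cases hi : i = l
        · subst hi
          exact hc
        · exact (hoff' i hi).symm)
      have hb := (gmap_false x b l).1 hl.1
      have ha := (gmap_false x a l).1 (hg ▸ hl.1)
      have hle := hba.le l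
      rcases hb with hb | hb <;> rcases ha with ha | ha
      · exact hne (hb.trans ha.symm)
      · exact h l ⟨hl, hb, ha, hoff'⟩
      · rw [hb, ha] at hle
        simp at hle
      · exact hne (hb.trans ha.symm)
    · push Not at hall
      exact hba.ne (funext fun i => (hoff i (hall i)).symm)

lemma gmap_bElt (hn : 0 < n) (x : ∀ i, F i) (i : Fin n) : gmap x (bElt hn x) i = false := by
  rw [gmap_false]
  by_cases h : i = ⟨0, hn⟩ <;> simp [bElt, h]

/-- A tuple which is not all-true under `gmap` is a member of an up pair, or is `b`. -/
lemma exists_upPair (hn : 0 < n) (x : ∀ i, F i) (σ : ∀ i, WithBot (F i))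
    (h0 : gmap x σ ≠ fun _ => true) (hb : σ ≠ bElt hn x) (hs : σ ≠ fun _ => ⊥) :
    ∃ (τ : ∀ i, WithBot (F i)) (l : Fin n), τ ≠ (fun _ => ⊥) ∧
      (UpPair x l σ τ ∨ UpPair x l τ σ) := by
  obtain ⟨l, hl⟩ := exists_leastF x σ h0
  rcases (gmap_false x σ l).1 hl.1 with h | h
  · refine ⟨Function.update σ l (x l : WithBot (F l)), l, fun e => ?_, Or.inl
      ⟨hl, h, by simp, fun i hi => by simp [hi]⟩⟩
    have := congrFun e l
    simp at this
  · have e : gmap x (Function.update σ l ⊥) = gmap x σ := by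
      funext i
      by_cases hi : i = l
      · subst hi
        simp [gmap, h]
      · simp [gmap, hi]
    refine ⟨Function.update σ l ⊥, l, fun e => hb ?_, Or.inr
      ⟨(leastF_congr e l).2 hl, by simp, h, fun i hi => by simp [hi]⟩⟩
    have hoff : ∀ i, i ≠ l → σ i = ⊥ := fun i hi => by
      have := congrFun e i
      simpa [hi] using this
    have hl0 : l = ⟨0, hn⟩ := by
      by_contra hc
      have hlt : (⟨0, hn⟩ : Fin n) < l := by
        rw [Fin.lt_def]
        have : l.val ≠ 0 := fun h => hc (Fin.ext h)
        simp only
        omega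
      have h1 := hl.2 _ hlt
      have h2 := (gmap_false x σ ⟨0, hn⟩).2 (Or.inl (hoff _ hlt.ne))
      rw [h1] at h2
      cases h2
    funext i
    by_cases hi : i = l
    · subst hi
      simp [bElt, ← hl0, h]
    · rw [hoff i hi]
      simp [bElt, ← hl0, hi]

lemma not_upPair_bElt_left (hn : 0 < n) (x : ∀ i, F i) (l : Fin n) (τ : ∀ i, WithBot (F i)) :
    ¬ UpPair x l (bElt hn x) τ := by
  rintro ⟨h0, h1, _, _⟩
  by_cases hl : l = ⟨0, hn⟩
  · simp [bElt, hl] at h1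
  · have hlt : (⟨0, hn⟩ : Fin n) < l := by
      rw [Fin.lt_def]
      have : l.val ≠ 0 := fun h => hl (Fin.ext h)
      simp only
      omega
    have := h0.2 _ hlt
    rw [gmap_bElt] at this
    cases this

lemma not_upPair_bElt_right (hn : 0 < n) (x : ∀ i, F i) (l : Fin n) (τ : ∀ i, WithBot (F i))
    (ht : τ ≠ fun _ => ⊥) : ¬ UpPair x l τ (bElt hn x) := by
  rintro ⟨h0, h1, h2, h3⟩
  have hl : l = ⟨0, hn⟩ := by
    by_contra hl
    simp [bElt, hl] at h2
  apply ht
  funext i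
  by_cases hi : i = l
  · subst hi
    exact h1
  · rw [← h3 i hi]
    simp [bElt, ← hl, hi]

lemma UpPair.not_allTrue {x : ∀ i, F i} {l : Fin n} {a b : ∀ i, WithBot (F i)}
    (h : UpPair x l a b) : gmap x a ≠ fun _ => true := by
  intro e
  have := h.1.1
  rw [e] at this
  cases this

end JoinHelpers

/-- **Combinatorial content of Lemma 3.5 of the paper.**
Let `n ≥ 1` and let `F₁, …, Fₙ` be finite posets with chosen minimal elements `xᵢ ∈ Fᵢ`.
Let `P` be the poset of `n`-tuples `σ` with `σᵢ ∈ Option Fᵢ` (with `none` adjoined below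
every element of `Fᵢ`), ordered componentwise, with the all-`none` tuple removed, and let
`g : P → Boolⁿ` be given by `g σ i = true` iff `σᵢ ∉ {none, some xᵢ}`.  Let `M` be the set
of covering pairs of `P` obtained by pairing each `σ` with `g σ ≠ (true, …, true)` with the
tuple obtained by toggling coordinate `l` between `none` and `some (x l)`, where `l` is the
smallest index with `g σ l = false`; the pair involving only `b = (some x₁, none, …, none)`
is omitted.  Then `M` is an acyclic matching on `P`, the unmatched elements are exactly `b`
together with the elements with `g σ = (true, …, true)`, and the set `Z` of matched
elements together with `b` is a lower set of `P` containing every tuple with at least one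
coordinate equal to `none`. -/
theorem join_acyclic_matching
    {n : ℕ} (hn : 0 < n) {F : Fin n → Type*}
    [∀ i, Fintype (F i)] [∀ i, PartialOrder (F i)] [∀ i, DecidableEq (F i)]
    (x : ∀ i, F i) (hx : ∀ i, IsMin (x i)) :
    -- the poset `P` (product of the `Option Fᵢ` with the all-`none` tuple removed)
    let P := {σ : ∀ i, WithBot (F i) // σ ≠ fun _ => ⊥}
    -- the matching `M`: each pair consists of a tuple and its toggle at the least
    -- index where `g` is `false` (pairs through the all-`none` tuple, i.e. the pair
    -- involving only `b`, are automatically omitted since `P` omits that tuple)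
    let M : Set (P × P) := {p | p.1 < p.2 ∧ ∃ l : Fin n,
      gmap x p.1.1 l = false ∧ (∀ j : Fin n, j < l → gmap x p.1.1 j = true) ∧
      p.2.1 = toggle x l p.1.1}
    -- the set of matched elements
    let matched : Set P := {σ | ∃ p ∈ M, σ = p.1 ∨ σ = p.2}
    -- `Z` = matched elements together with `b`
    let Z : Set P := matched ∪ {σ : P | σ.1 = bElt hn x}
    -- each pair of `M` is a covering pair of `P`
    (∀ p ∈ M, p.1 ⋖ p.2) ∧
    -- every element of `P` occurs in at most one pair of `M`
    (∀ p ∈ M, ∀ p' ∈ M,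
      (p.1 = p'.1 ∨ p.1 = p'.2 ∨ p.2 = p'.1 ∨ p.2 = p'.2) → p = p') ∧
    -- `M` is acyclic: the modified Hasse relation has no directed cycle
    Irreflexive (Relation.TransGen (fun a b : P =>
      (b ⋖ a ∧ (b, a) ∉ M) ∨ (a ⋖ b ∧ (a, b) ∈ M))) ∧
    -- the unmatched elements are exactly `b` and the elements with `g σ = (true, …, true)`
    (∀ σ : P, σ ∉ matched ↔ (σ.1 = bElt hn x ∨ gmap x σ.1 = fun _ => true)) ∧
    -- `Z` is a lower set of `P` …
    (∀ σ ∈ Z, ∀ τ : P, τ ≤ σ → τ ∈ Z) ∧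
    -- … containing every tuple with at least one coordinate equal to `none`
    (∀ σ : P, (∃ i : Fin n, σ.1 i = ⊥) → σ ∈ Z) := by
  intro P M matched Z
  have hM : ∀ p : P × P, p ∈ M ↔ ∃ l, UpPair x l p.1.1 p.2.1 := by
    intro p
    constructor
    · rintro ⟨hlt, l, h1, h2, h3⟩
      exact ⟨l, upPair_of_toggle ⟨h1, h2⟩ hlt h3⟩
    · rintro ⟨l, h⟩
      exact ⟨h.lt, l, h.1.1, h.1.2, h.toggle_eq⟩
  have hmat : ∀ σ : P, σ ∈ matched ↔
      (σ.1 ≠ bElt hn x ∧ gmap x σ.1 ≠ fun _ => true) := by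
    intro σ
    constructor
    · rintro ⟨p, hp, hs⟩
      obtain ⟨l, h⟩ := (hM p).1 hp
      rcases hs with hs | hs
      · rw [hs]
        exact ⟨fun e => not_upPair_bElt_left hn x l p.2.1 (e ▸ h), h.not_allTrue⟩
      · rw [hs]
        refine ⟨fun e => not_upPair_bElt_right hn x l p.1.1 p.1.2 (e ▸ h), ?_⟩
        rw [← h.gmap_eq]
        exact h.not_allTrue
    · rintro ⟨h1, h2⟩
      obtain ⟨τ, l, ht, h | h⟩ := exists_upPair hn x σ.1 h2 h1 σ.2
      · exact ⟨(σ, ⟨τ, ht⟩), (hM _).2 ⟨l, h⟩, Or.inl rfl⟩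
      · exact ⟨(⟨τ, ht⟩, σ), (hM _).2 ⟨l, h⟩, Or.inr rfl⟩
  have hZ : ∀ σ : P, σ ∈ Z ↔ gmap x σ.1 ≠ fun _ => true := by
    intro σ
    have hb : σ.1 = bElt hn x → gmap x σ.1 ≠ fun _ => true := by
      intro e e'
      have := gmap_bElt hn x ⟨0, hn⟩
      rw [← e, e'] at this
      cases this
    have : σ ∈ Z ↔ σ ∈ matched ∨ σ.1 = bElt hn x := Iff.rfl
    rw [this, hmat]
    tauto
  refine ⟨?_, ?_, ?_, ?_, ?_, ?_⟩
  · intro p hp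
    obtain ⟨l, h⟩ := (hM p).1 hp
    refine ⟨h.lt, fun c hac hcb => ?_⟩
    rcases h.eq_or hx (c := c.1) hac.le hcb.le with e | e
    · exact hac.ne (Subtype.ext e.symm)
    · exact hcb.ne (Subtype.ext e)
  · intro p hp p' hp' hor
    obtain ⟨l, h⟩ := (hM p).1 hp
    obtain ⟨m, h'⟩ := (hM p').1 hp'
    have hg : gmap x p.1.1 = gmap x p'.1.1 := by
      rcases hor with e | e | e | e
      · rw [e]
      · rw [e, h'.gmap_eq]
      · rw [h.gmap_eq, e]
      · rw [h.gmap_eq, e, h'.gmap_eq]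
    obtain rfl := h.1.unique h'.1 hg
    obtain ⟨_, h1, h2, h3⟩ := h
    obtain ⟨_, h1', h2', h3'⟩ := h'
    rcases hor with e | e | e | e
    · refine Prod.ext e (Subtype.ext (funext fun i => ?_))
      by_cases hi : i = l
      · subst hi
        rw [h2, h2']
      · rw [h3 i hi, h3' i hi, e]
    · rw [e, h2'] at h1
      exact absurd h1 WithBot.coe_ne_bot
    · rw [e, h1'] at h2
      exact absurd h2.symm WithBot.coe_ne_bot
    · refine Prod.ext (Subtype.ext (funext fun i => ?_)) e
      by_cases hi : i = l
      · subst hi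
        rw [h1, h1']
      · rw [← h3 i hi, ← h3' i hi, e]
  · have key : ∀ a b : P, Relation.TransGen (fun a b : P =>
      (b ⋖ a ∧ (b, a) ∉ M) ∨ (a ⋖ b ∧ (a, b) ∈ M)) a b → Desc x a.1 b.1 := by
      intro a b h
      have step : ∀ a b : P, ((b ⋖ a ∧ (b, a) ∉ M) ∨ (a ⋖ b ∧ (a, b) ∈ M)) →
          Desc x a.1 b.1 := by
        rintro a b (⟨h1, h2⟩ | ⟨_, h2⟩)
        · exact desc_of_lt hx h1.lt (fun l hl => h2 ((hM _).2 ⟨l, hl⟩))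
        · obtain ⟨l, hl⟩ := (hM _).1 h2
          exact hl.desc
      induction h with
      | single h => exact step _ _ h
      | tail _ h ih => exact ih.trans (step _ _ h)
    exact fun a h => Desc.irrefl x a.1 (key a a h)
  · intro σ
    rw [hmat]
    tauto
  · intro σ hσ τ hle
    rw [hZ] at hσ ⊢
    intro e
    apply hσ
    have := gmap_mono x hx (show τ.1 ≤ σ.1 from hle)
    funext i
    have hi := this i
    rw [e] at hi
    exact top_le_iff.1 hi
  · rintro σ ⟨i, hi⟩
    rw [hZ]
    intro e
    have := (gmap_false x σ.1 i).2 (Or.inl hi)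
    rw [e] at this
    cases this
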